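/- Let q be a positive definite quadratic form on ℝ^d. Then there exists an entire function g : ℂ → ℂ such that for all s with Re(s) > d/2, Σ_{n∈ℤ^d∖{0}} q(n)^{−s} = g(s) + (1/(2s−d)) ∫_{S^{d−1}} q(ω)^{−d/2} dμ_S(ω). In particular, the Epstein zeta function Z_q(s) = Σ_{n∈ℤ^d∖{0}} q(n)^{−s} extends meromorphically to all of ℂ with a single, simple pole at s = d/2, of residue (1/2) ∫_{S^{d−1}} q(ω)^{−d/2} dμ_S(ω). -/

import Mathlib

open MeasureTheory Filter Finset Complex Metric
open scoped Topology

noncomputable section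

/-- The vector of `ℝ^d` with integer coordinates `n ∈ ℤ^d`. -/
noncomputable def intVec {d : ℕ} (n : Fin d → ℤ) : EuclideanSpace ℝ (Fin d) :=
  (EuclideanSpace.equiv (Fin d) ℝ).symm fun i => (n i : ℝ)

/-- The surface measure `μ_S` on the unit sphere `S^{d−1} ⊂ ℝ^d` induced by Lebesgue measure. -/
noncomputable def sphereMeasure (d : ℕ) : Measure (sphere (0 : EuclideanSpace ℝ (Fin d)) 1) :=
  (volume : Measure (EuclideanSpace ℝ (Fin d))).toSphere

section Poisson

open TopologicalSpace

variable {ι : Type*}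

lemma iUnion_setOf_sub_intCast_mem_Ioc :
    ⋃ n : ι → ℤ, {x : ι → ℝ | ∀ i, x i - n i ∈ Set.Ioc (0 : ℝ) 1} = Set.univ := by
  refine Set.eq_univ_of_forall fun x => Set.mem_iUnion.2 ⟨fun i => ⌈x i⌉ - 1, fun i => ?_⟩
  have h1 := Int.ceil_lt_add_one (x i)
  have h2 := Int.le_ceil (x i)
  push_cast
  constructor <;> linarith

lemma pairwise_disjoint_setOf_sub_intCast_mem_Ioc :
    Pairwise (Function.onFun Disjoint
      fun n : ι → ℤ => {x : ι → ℝ | ∀ i, x i - n i ∈ Set.Ioc (0 : ℝ) 1}) := by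
  intro m n hmn
  refine Set.disjoint_left.2 fun x hx hy => hmn (funext fun i => ?_)
  obtain ⟨h1, h2⟩ := hx i
  obtain ⟨h3, h4⟩ := hy i
  have h5 : (m i : ℝ) < n i + 1 := by linarith
  have h6 : (n i : ℝ) < m i + 1 := by linarith
  norm_cast at h5 h6
  omega

variable [Fintype ι]

/-- The integral of `f` over `ℝ^ι` is the sum of the integrals over the unit cube of the integer
translates of `f`. -/
lemma hasSum_integral_unitCube_add_intCast {E : Type*} [NormedAddCommGroup E] [NormedSpace ℝ E]
    {f : (ι → ℝ) → E} (hf : Integrable f) :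
    HasSum (fun n : ι → ℤ => ∫ x in {x : ι → ℝ | ∀ i, x i ∈ Set.Ioc (0 : ℝ) 1},
      f (x + fun i => (n i : ℝ))) (∫ x, f x) := by
  have key := hasSum_integral_iUnion (μ := (volume : Measure (ι → ℝ))) (f := f)
    (s := fun n : ι → ℤ => {x : ι → ℝ | ∀ i, x i - n i ∈ Set.Ioc (0 : ℝ) 1})
    (fun n => by
      have : {x : ι → ℝ | ∀ i, x i - n i ∈ Set.Ioc (0 : ℝ) 1} =
          Set.univ.pi fun i : ι => Set.Ioc (n i : ℝ) (n i + 1) := by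
        ext x
        simp [add_comm]
      rw [this]
      exact MeasurableSet.univ_pi fun i => measurableSet_Ioc)
    pairwise_disjoint_setOf_sub_intCast_mem_Ioc hf.integrableOn
  rw [iUnion_setOf_sub_intCast_mem_Ioc, setIntegral_univ] at key
  convert key using 2 with n
  rw [← (measurePreserving_add_right volume fun i => (n i : ℝ)).setIntegral_preimage_emb
    (measurableEmbedding_addRight _) f]
  simp

lemma integrable_of_summable_norm_unitCube {E : Type*} [NormedAddCommGroup E] [NormedSpace ℝ E]
    {f : C(ι → ℝ, E)}
    (hf : ∀ K : Compacts (ι → ℝ), Summable fun n : ι → ℤ =>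
      ‖(f.comp (ContinuousMap.addRight fun i => (n i : ℝ))).restrict K‖) :
    Integrable f := by
  refine integrable_of_summable_norm_restrict
    (s := fun n : ι → ℤ => ⟨Set.Icc (fun i => (n i : ℝ)) (fun i => (n i : ℝ) + 1), isCompact_Icc⟩)
    (.of_nonneg_of_le (fun n => by positivity) (fun n => ?_)
      (hf ⟨Set.Icc 0 1, isCompact_Icc⟩)) ?_
  · have : (volume : Measure (ι → ℝ)).real
        (Set.Icc (fun i => (n i : ℝ)) (fun i => (n i : ℝ) + 1)) = 1 := by
      simp [Measure.real, Real.volume_Icc_pi]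
    simp only [Compacts.coe_mk, this, mul_one]
    rw [ContinuousMap.norm_le _ (norm_nonneg _)]
    rintro ⟨x, hx⟩
    have hx' : x - (fun i => (n i : ℝ)) ∈ (⟨Set.Icc 0 1, isCompact_Icc⟩ : Compacts (ι → ℝ)) := by
      constructor
      · intro i; simpa using hx.1 i
      · intro i; simpa [sub_le_iff_le_add, add_comm] using hx.2 i
    simpa using ((f.comp (ContinuousMap.addRight fun i => (n i : ℝ))).restrict
      ((⟨Set.Icc 0 1, isCompact_Icc⟩ : Compacts (ι → ℝ)) : Set (ι → ℝ))).norm_coe_le_norm ⟨_, hx'⟩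
  · refine Set.eq_univ_of_forall fun x => Set.mem_iUnion.2 ⟨fun i => ⌊x i⌋, ?_, ?_⟩
    · exact fun i => Int.floor_le _
    · exact fun i => (Int.lt_floor_add_one _).le

/-- **Poisson summation formula** on `ℝ^ι`. -/
theorem tsum_intCast_eq_tsum_integral_mFourier {f : C(ι → ℝ, ℂ)}
    (hf : ∀ K : Compacts (ι → ℝ), Summable fun n : ι → ℤ =>
      ‖(f.comp (ContinuousMap.addRight fun i => (n i : ℝ))).restrict K‖)
    (hs : Summable fun m : ι → ℤ =>
      ∫ x : ι → ℝ, UnitAddTorus.mFourier (-m) (fun i => (x i : UnitAddCircle)) * f x) :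
    ∑' n : ι → ℤ, f (fun i => (n i : ℝ)) =
      ∑' m : ι → ℤ, ∫ x : ι → ℝ,
        UnitAddTorus.mFourier (-m) (fun i => (x i : UnitAddCircle)) * f x := by
  classical
  let π : (ι → ℝ) → UnitAddTorus ι := Pi.map fun _ => ((↑) : ℝ → UnitAddCircle)
  have hπ : IsOpenQuotientMap π := .piMap fun _ => QuotientAddGroup.isOpenQuotientMap_mk
  let tr : (ι → ℤ) → C(ι → ℝ, ℂ) := fun n =>
    f.comp (ContinuousMap.addRight fun i => (n i : ℝ))
  have htr : Summable tr := ContinuousMap.summable_of_locally_summable_norm hf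
  let G : C(ι → ℝ, ℂ) := ∑' n, tr n
  have hG (x) : HasSum (fun n => tr n x) (G x) := ContinuousMap.hasSum_apply htr.hasSum x
  have hGper (x : ι → ℝ) (m : ι → ℤ) : G (x + fun i => (m i : ℝ)) = G x := by
    refine (hG _).unique ?_
    have := (Equiv.addLeft m).hasSum_iff.2 (hG x)
    convert this using 2 with n
    simp only [tr, ContinuousMap.comp_apply, ContinuousMap.coe_addRight, Function.comp_apply,
      Equiv.coe_addLeft]
    congr 1
    ext i
    simp [add_assoc]
  have hGπ (x y : ι → ℝ) (h : π x = π y) : G x = G y := by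
    have h' (i : ι) : ∃ k : ℤ, (k : ℝ) = y i - x i := by
      have := congr_fun h i
      simpa [π, QuotientAddGroup.eq, AddSubgroup.mem_zmultiples_iff, sub_eq_neg_add] using this
    choose k hk using h'
    rw [← hGper x k]
    congr 1
    ext i
    simp [hk]
  let s : UnitAddTorus ι → (ι → ℝ) := Function.surjInv hπ.surjective
  have hGs (x) : G (s (π x)) = G x := hGπ _ _ (Function.surjInv_eq hπ.surjective _)
  let F : C(UnitAddTorus ι, ℂ) := ⟨fun y => G (s y), by
    refine hπ.isQuotientMap.continuous_iff.2 ?_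
    convert G.continuous using 1
    ext x
    exact hGs x⟩
  have hF (x) : F (π x) = G x := hGs x
  have hint : Integrable f := integrable_of_summable_norm_unitCube hf
  let e (m : ι → ℤ) : C(ι → ℝ, ℂ) := (UnitAddTorus.mFourier (-m)).comp ⟨π, hπ.continuous⟩
  have he (m x) : ‖e m x‖ = 1 := by
    simp only [e, UnitAddTorus.mFourier, ContinuousMap.comp_apply, ContinuousMap.coe_mk, norm_prod,
      fourier_apply, Circle.norm_coe, Finset.prod_const_one]
  have heper (m n : ι → ℤ) (x) : e m (x + fun i => (n i : ℝ)) = e m x := by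
    simp only [e, ContinuousMap.comp_apply, ContinuousMap.coe_mk]
    congr 1
    ext i
    simp [π]
  have hcoeff (m : ι → ℤ) : UnitAddTorus.mFourierCoeff F m = ∫ x, e m x * f x := by
    have hefint : Integrable (fun x => e m x * f x) :=
      hint.bdd_mul (c := 1) (e m).continuous.aestronglyMeasurable (by simp [he])
    rw [UnitAddTorus.mFourierCoeff_eq_integral F m 0,
      ← (hasSum_integral_unitCube_add_intCast hefint).tsum_eq]
    have h0 : {x : ι → ℝ | ∀ i, x i ∈ Set.Ioc ((0 : ι → ℝ) i) ((0 : ι → ℝ) i + 1)} =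
        {x : ι → ℝ | ∀ i, x i ∈ Set.Ioc (0 : ℝ) 1} := by simp
    have hvol : (volume : Measure (ι → ℝ)).real {x : ι → ℝ | ∀ i, x i ∈ Set.Ioc (0 : ℝ) 1} = 1 := by
      have : {x : ι → ℝ | ∀ i, x i ∈ Set.Ioc (0 : ℝ) 1} = Set.univ.pi fun _ => Set.Ioc 0 1 := by
        ext; simp
      rw [this]
      simp [Measure.real, Real.volume_pi_Ioc]
    rw [h0, integral_tsum_of_summable_integral_norm]
    · refine integral_congr_ae (ae_of_all _ fun x => ?_)
      simp only [heper, tsum_mul_left]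
      change e m x • F (π x) = _
      rw [hF, smul_eq_mul, ← (hG x).tsum_eq]
      rfl
    · intro n
      exact ((hefint.comp_add_right _)).integrableOn
    · refine Summable.of_nonneg_of_le (fun n => by positivity) (fun n => ?_)
        (hf ⟨Set.Icc 0 1, isCompact_Icc⟩)
      refine (Real.le_norm_self _).trans ((norm_setIntegral_le_of_norm_le_const
        (C := ‖(tr n).restrict (Set.Icc (0 : ι → ℝ) 1)‖) ?_ fun x hx => ?_).trans_eq ?_)
      · refine lt_top_iff_ne_top.2 fun h => ?_
        simp only [Measure.real, h, ENNReal.toReal_top, zero_ne_one] at hvol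
      · have hx' : x ∈ (Set.Icc 0 1 : Set (ι → ℝ)) := ⟨fun i => (hx i).1.le, fun i => (hx i).2⟩
        rw [norm_norm, norm_mul, he, one_mul]
        exact ((tr n).restrict (((⟨Set.Icc 0 1, isCompact_Icc⟩ : Compacts (ι → ℝ)) :
          Set (ι → ℝ)))).norm_coe_le_norm ⟨x, hx'⟩
      · rw [hvol, mul_one]
        rfl
  have hsF : Summable (UnitAddTorus.mFourierCoeff F) := by
    simp_rw [funext hcoeff]
    exact hs
  have key := UnitAddTorus.hasSum_mFourier_series_apply_of_summable hsF (π 0)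
  rw [hF] at key
  have h1 : ∑' n : ι → ℤ, f (fun i => (n i : ℝ)) = G 0 := by
    rw [← (hG 0).tsum_eq]
    simp [tr]
  rw [h1, ← key.tsum_eq]
  refine tsum_congr fun m => ?_
  rw [hcoeff]
  have : UnitAddTorus.mFourier m (π 0) = 1 := by simp [UnitAddTorus.mFourier, π]
  rw [this, smul_eq_mul, mul_one]
  rfl

end Poisson

section Theta

variable {d : ℕ} (T : EuclideanSpace ℝ (Fin d) ≃L[ℝ] EuclideanSpace ℝ (Fin d))

lemma intVec_injective : Function.Injective (intVec (d := d)) := by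
  intro m n h
  ext i
  simpa [intVec] using congr_arg (fun v : EuclideanSpace ℝ (Fin d) => v i) h

@[simp]
lemma intVec_zero : intVec (0 : Fin d → ℤ) = 0 := by
  ext i
  simp [intVec]

lemma intVec_ne_zero {n : Fin d → ℤ} (hn : n ≠ 0) : intVec n ≠ 0 := by
  rw [← intVec_zero]
  exact intVec_injective.ne hn

lemma norm_apply_intVec_pos {n : Fin d → ℤ} (hn : n ≠ 0) : 0 < ‖T (intVec n)‖ := by
  simpa using intVec_ne_zero hn

lemma summable_norm_apply_intVec_rpow {r : ℝ} (hr : r < -d) :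
    Summable fun n : Fin d → ℤ => ‖T (intVec n)‖ ^ r := by
  let b := (EuclideanSpace.basisFun (Fin d) ℝ).toBasis.map T.toLinearEquiv
  let L := Submodule.span ℤ (Set.range b)
  have hmem (n : Fin d → ℤ) : T (intVec n) ∈ L := by
    have : T (intVec n) = ∑ i, n i • b i := by
      have : intVec n = ∑ i, n i • EuclideanSpace.basisFun (Fin d) ℝ i := by
        ext j
        simp [intVec, Pi.single_apply, Finset.sum_apply]
      rw [this, map_sum]
      simp [b]
    rw [this]
    exact sum_mem fun i _ => L.smul_mem _ (Submodule.subset_span ⟨i, rfl⟩)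
  have hL : Module.finrank ℤ L = d := by
    rw [ZLattice.rank ℝ L]
    simp
  refine (ZLattice.summable_norm_rpow L r (by rw [hL]; exact hr)).comp_injective
    (i := fun n => (⟨T (intVec n), hmem n⟩ : L)) fun m n h => ?_
  exact intVec_injective (T.injective (congr_arg Subtype.val h))

lemma exp_neg_le_factorial_mul_inv_pow {x : ℝ} (hx : 0 < x) (k : ℕ) :
    Real.exp (-x) ≤ k.factorial * (x ^ k)⁻¹ := by
  rw [Real.exp_neg, ← div_eq_mul_inv, ← inv_div]
  exact inv_anti₀ (by positivity) (Real.pow_div_factorial_le_exp x hx.le k)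

lemma exp_norm_apply_intVec_le {n : Fin d → ℤ} (hn : n ≠ 0) {t : ℝ} (ht : 0 < t) (k : ℕ) :
    Real.exp (-Real.pi * ‖T (intVec n)‖ ^ 2 * t) ≤
      (k.factorial * (Real.pi ^ k)⁻¹ * (t ^ k)⁻¹) * ‖T (intVec n)‖ ^ (-(2 * k : ℝ)) := by
  have h := norm_apply_intVec_pos T hn
  have := exp_neg_le_factorial_mul_inv_pow (x := Real.pi * ‖T (intVec n)‖ ^ 2 * t) (by positivity) k
  rw [Real.rpow_neg h.le]
  rw [show (2 * k : ℝ) = ((2 * k : ℕ) : ℝ) by push_cast; rfl, Real.rpow_natCast]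
  convert this using 1
  · ring_nf
  · rw [mul_pow, mul_pow, ← pow_mul, mul_inv, mul_inv]
    ring

lemma summable_exp_norm_apply_intVec {t : ℝ} (ht : 0 < t) :
    Summable fun n : Fin d → ℤ => Real.exp (-Real.pi * ‖T (intVec n)‖ ^ 2 * t) := by
  have h1 := (summable_norm_apply_intVec_rpow T (r := -(2 * (d + 1 : ℕ) : ℝ))
    (by push_cast; linarith [Nat.cast_nonneg (α := ℝ) d])).mul_left
      ((d + 1).factorial * (Real.pi ^ (d + 1))⁻¹ * (t ^ (d + 1))⁻¹)
  refine h1.of_norm_bounded_eventually ?_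
  rw [Filter.eventually_cofinite]
  refine (Set.finite_singleton (0 : Fin d → ℤ)).subset fun n hn => ?_
  by_contra h0
  refine hn ?_
  rw [Real.norm_of_nonneg (Real.exp_pos _).le]
  exact exp_norm_apply_intVec_le T h0 ht _

/-- The theta function of the lattice `T(ℤ^d)`. -/
def latticeTheta (t : ℝ) : ℝ := ∑' n : Fin d → ℤ, Real.exp (-Real.pi * ‖T (intVec n)‖ ^ 2 * t)

lemma hasSum_latticeTheta_sub_one {t : ℝ} (ht : 0 < t) :
    HasSum (fun n : {n : Fin d → ℤ // n ≠ 0} => Real.exp (-Real.pi * ‖T (intVec n.1)‖ ^ 2 * t))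
      (latticeTheta T t - 1) := by
  have h := (summable_exp_norm_apply_intVec T ht).hasSum
  have h1 := hasSum_singleton (0 : Fin d → ℤ)
    fun n : Fin d → ℤ => Real.exp (-Real.pi * ‖T (intVec n)‖ ^ 2 * t)
  have h2 := (HasSum.hasSum_iff_compl (s := {(0 : Fin d → ℤ)})
    (f := fun n : Fin d → ℤ => Real.exp (-Real.pi * ‖T (intVec n)‖ ^ 2 * t)) h1).1 h
  rw [intVec_zero, map_zero, norm_zero, zero_pow two_ne_zero, mul_zero, zero_mul,
    Real.exp_zero] at h2
  exact h2

lemma antitoneOn_latticeTheta : AntitoneOn (latticeTheta T) (Set.Ioi 0) := by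
  intro s hs t ht hst
  refine (summable_exp_norm_apply_intVec T ht).tsum_le_tsum (fun n => ?_)
    (summable_exp_norm_apply_intVec T hs)
  rw [Real.exp_le_exp, neg_mul, neg_mul, neg_mul, neg_le_neg_iff]
  gcongr

lemma locallyIntegrableOn_latticeTheta :
    LocallyIntegrableOn (fun t => (latticeTheta T t : ℂ)) (Set.Ioi 0) := by
  rw [locallyIntegrableOn_iff isOpen_Ioi.isLocallyClosed]
  intro k hk hkc
  exact ((antitoneOn_latticeTheta T).mono hk |>.integrableOn_isCompact hkc).ofReal

lemma latticeTheta_sub_one_isBigO (r : ℝ) :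
    (fun t => (latticeTheta T t : ℂ) - 1) =O[atTop] fun t : ℝ => t ^ r := by
  obtain ⟨k, hk⟩ := exists_nat_gt (max (d : ℝ) (-r))
  have hkd : (d : ℝ) < k := (le_max_left _ _).trans_lt hk
  have hkr : -r < k := (le_max_right _ _).trans_lt hk
  have hs := (summable_norm_apply_intVec_rpow T (r := -(2 * k : ℝ))
    (by linarith [Nat.cast_nonneg (α := ℝ) d])).subtype {n | n ≠ 0}
  refine Asymptotics.IsBigO.of_bound (k.factorial * (Real.pi ^ k)⁻¹ *
    ∑' n : {n : Fin d → ℤ // n ≠ 0}, ‖T (intVec n.1)‖ ^ (-(2 * k : ℝ))) ?_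
  filter_upwards [eventually_ge_atTop 1] with t ht
  have ht0 : 0 < t := by linarith
  have h1 := hasSum_latticeTheta_sub_one T ht0
  have h2 : latticeTheta T t - 1 ≤ (k.factorial * (Real.pi ^ k)⁻¹ * (t ^ k)⁻¹) *
      ∑' n : {n : Fin d → ℤ // n ≠ 0}, ‖T (intVec n.1)‖ ^ (-(2 * k : ℝ)) :=
    hasSum_le (fun n => exp_norm_apply_intVec_le T n.2 ht0 k) h1 (hs.hasSum.mul_left _)
  have h3 : 0 ≤ latticeTheta T t - 1 := h1.nonneg fun n => (Real.exp_pos _).le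
  rw [← ofReal_one, ← ofReal_sub, norm_real, Real.norm_of_nonneg h3,
    Real.norm_of_nonneg (by positivity)]
  refine h2.trans ?_
  rw [mul_right_comm]
  gcongr
  rw [← Real.rpow_natCast, ← Real.rpow_neg ht0.le]
  exact Real.rpow_le_rpow_of_exponent_le ht (by linarith)

/-- `|det T|⁻¹`, the inverse covolume of the lattice `T(ℤ^d)`. -/
def invCovolume : ℝ :=
  |LinearMap.det (T : EuclideanSpace ℝ (Fin d) →ₗ[ℝ] EuclideanSpace ℝ (Fin d))|⁻¹

lemma invCovolume_pos : 0 < invCovolume T :=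
  inv_pos.2 (abs_pos.2 (LinearEquiv.isUnit_det' T.toLinearEquiv).ne_zero)

lemma integral_comp_eq_invCovolume_smul {F : Type*} [NormedAddCommGroup F] [NormedSpace ℝ F]
    (h : EuclideanSpace ℝ (Fin d) → F) :
    ∫ x, h (T x) = invCovolume T • ∫ y, h y := by
  have hdet : LinearMap.det (T : EuclideanSpace ℝ (Fin d) →ₗ[ℝ] EuclideanSpace ℝ (Fin d)) ≠ 0 :=
    (LinearEquiv.isUnit_det' T.toLinearEquiv).ne_zero
  have h1 := Measure.map_linearMap_addHaar_eq_smul_addHaar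
    (volume : Measure (EuclideanSpace ℝ (Fin d))) hdet
  have h2 := (T.toHomeomorph.measurableEmbedding).integral_map
    (μ := (volume : Measure (EuclideanSpace ℝ (Fin d)))) h
  have h3 : Measure.map T.toHomeomorph (volume : Measure (EuclideanSpace ℝ (Fin d))) =
    Measure.map (T : EuclideanSpace ℝ (Fin d) →ₗ[ℝ] EuclideanSpace ℝ (Fin d)) volume := rfl
  rw [h3, h1, integral_smul_measure, ENNReal.toReal_ofReal (abs_nonneg _), abs_inv] at h2
  exact h2.symm

open scoped RealInnerProductSpace

lemma integral_cexp_norm_apply_add_inner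
    {T' : EuclideanSpace ℝ (Fin d) ≃L[ℝ] EuclideanSpace ℝ (Fin d)}
    (hT : ∀ w x, ⟪T' w, T x⟫ = ⟪w, x⟫) {t : ℝ} (ht : 0 < t) (w : EuclideanSpace ℝ (Fin d)) :
    ∫ x : EuclideanSpace ℝ (Fin d),
      cexp (-(Real.pi * t : ℝ) * ‖T x‖ ^ 2 + (-2 * Real.pi * I) * ⟪w, x⟫) =
      (invCovolume T * t ^ (-(d : ℝ) / 2) * Real.exp (-Real.pi * ‖T' w‖ ^ 2 * t⁻¹) : ℝ) := by
  have h := integral_comp_eq_invCovolume_smul T fun y =>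
    cexp (-(Real.pi * t : ℝ) * ‖y‖ ^ 2 + (-2 * Real.pi * I) * ⟪T' w, y⟫)
  simp only [hT] at h
  rw [h, GaussianFourier.integral_cexp_neg_mul_sq_norm_add (by simp; positivity)]
  have hπ : (Real.pi : ℂ) ≠ 0 := by exact_mod_cast Real.pi_ne_zero
  have ht' : (t : ℂ) ≠ 0 := by exact_mod_cast ht.ne'
  have h1 : (Real.pi / (Real.pi * t : ℝ) : ℂ) = ((t⁻¹ : ℝ) : ℂ) := by
    push_cast
    field_simp
  have h2 : ((t⁻¹ : ℝ) : ℂ) ^ ((Module.finrank ℝ (EuclideanSpace ℝ (Fin d)) : ℂ) / 2) =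
      ((t ^ (-(d : ℝ) / 2) : ℝ) : ℂ) := by
    rw [neg_div, Real.rpow_neg ht.le, ← Real.inv_rpow ht.le, ofReal_cpow (by positivity)]
    simp
  rw [h1, h2]
  rw [real_smul, ← mul_assoc, ← ofReal_mul, ofReal_mul _ (Real.exp _), ofReal_exp]
  congr 2
  push_cast
  field_simp
  linear_combination (4 * (‖T' w‖ : ℂ) ^ 2) * I_sq

lemma half_norm_sq_sub_norm_sq_le {V : Type*} [SeminormedAddCommGroup V] (x y : V) :
    ‖y‖ ^ 2 / 2 - ‖x‖ ^ 2 ≤ ‖x + y‖ ^ 2 := by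
  have h : ‖y‖ ≤ ‖x + y‖ + ‖x‖ := by
    simpa using norm_sub_le (x + y) x
  nlinarith [norm_nonneg y, norm_nonneg (x + y), norm_nonneg x, sq_nonneg (‖x + y‖ - ‖x‖)]

/-- The functional equation of the theta function. -/
theorem latticeTheta_eq {T' : EuclideanSpace ℝ (Fin d) ≃L[ℝ] EuclideanSpace ℝ (Fin d)}
    (hT : ∀ w x, ⟪T' w, T x⟫ = ⟪w, x⟫) {t : ℝ} (ht : 0 < t) :
    latticeTheta T t = invCovolume T * t ^ (-(d : ℝ) / 2) * latticeTheta T' t⁻¹ := by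
  let f : C(Fin d → ℝ, ℂ) :=
    ⟨fun x => ((Real.exp (-Real.pi * ‖T (WithLp.toLp 2 x)‖ ^ 2 * t) : ℝ) : ℂ), by fun_prop⟩
  have hint (m : Fin d → ℤ) :
      ∫ x : Fin d → ℝ, UnitAddTorus.mFourier (-m) (fun i => (x i : UnitAddCircle)) * f x =
      (invCovolume T * t ^ (-(d : ℝ) / 2) *
        Real.exp (-Real.pi * ‖T' (intVec m)‖ ^ 2 * t⁻¹) : ℝ) := by
    rw [← integral_cexp_norm_apply_add_inner T hT ht,
      ← (PiLp.volume_preserving_toLp (Fin d)).integral_comp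
        (MeasurableEquiv.toLp 2 _).measurableEmbedding]
    refine integral_congr_ae (ae_of_all _ fun x => ?_)
    simp only [f, UnitAddTorus.mFourier, ContinuousMap.coe_mk, fourier_coe_apply, ofReal_exp]
    rw [← Complex.exp_sum, ← Complex.exp_add, add_comm]
    congr 2
    · push_cast
      ring
    · simp only [intVec, PiLp.inner_apply]
      push_cast
      rw [Finset.mul_sum]
      refine Finset.sum_congr rfl fun i _ => ?_
      simp
      ring
  have hloc : ∀ K : TopologicalSpace.Compacts (Fin d → ℝ), Summable fun n : Fin d → ℤ =>
      ‖(f.comp (ContinuousMap.addRight fun i => (n i : ℝ))).restrict K‖ := by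
    intro K
    obtain ⟨C, hC⟩ := K.isCompact.exists_bound_of_continuousOn
      (f := fun x => T (WithLp.toLp 2 x)) (by fun_prop)
    refine Summable.of_nonneg_of_le (fun n => norm_nonneg _) (fun n => ?_)
      ((summable_exp_norm_apply_intVec T (half_pos ht)).mul_left
        (Real.exp (Real.pi * C ^ 2 * t)))
    rw [ContinuousMap.norm_le _ (by positivity)]
    rintro ⟨x, hx⟩
    have hx' : ‖T (WithLp.toLp 2 x)‖ ^ 2 ≤ C ^ 2 := by
      gcongr
      exact hC x hx
    have hadd : T (WithLp.toLp 2 (x + fun i => (n i : ℝ))) =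
        T (WithLp.toLp 2 x) + T (intVec n) := by
      rw [← map_add]
      rfl
    have := half_norm_sq_sub_norm_sq_le (T (WithLp.toLp 2 x)) (T (intVec n))
    simp only [ContinuousMap.restrict_apply, ContinuousMap.comp_apply, ContinuousMap.coe_addRight,
      f, ContinuousMap.coe_mk, norm_real, hadd]
    rw [Real.norm_of_nonneg (Real.exp_pos _).le, ← Real.exp_add, Real.exp_le_exp]
    have h4 : 0 < Real.pi * t := by positivity
    nlinarith
  have hsum := (summable_exp_norm_apply_intVec T' (inv_pos.2 ht)).mul_left
    (invCovolume T * t ^ (-(d : ℝ) / 2))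
  have key := tsum_intCast_eq_tsum_integral_mFourier hloc (by
    simp_rw [hint]
    exact_mod_cast hsum)
  simp_rw [hint] at key
  rw [← ofReal_tsum, tsum_mul_left] at key
  rw [latticeTheta, latticeTheta, ← ofReal_inj, ← key, ofReal_tsum]
  rfl

end Theta

section Epstein

open scoped RealInnerProductSpace MatrixOrder

variable {d : ℕ}

lemma exists_norm_apply_sq_eq (A : Fin d → Fin d → ℝ) (q : EuclideanSpace ℝ (Fin d) → ℝ)
    (hq : ∀ x : EuclideanSpace ℝ (Fin d), q x = ∑ i, ∑ j, A i j * x i * x j)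
    (hpos : ∀ x : EuclideanSpace ℝ (Fin d), x ≠ 0 → 0 < q x) :
    ∃ T : EuclideanSpace ℝ (Fin d) ≃L[ℝ] EuclideanSpace ℝ (Fin d), ∀ x, q x = ‖T x‖ ^ 2 := by
  let M : Matrix (Fin d) (Fin d) ℝ := Matrix.of fun i j => (A i j + A j i) / 2
  have hM (x : Fin d → ℝ) : x ⬝ᵥ (M.mulVec x) = q (WithLp.toLp 2 x) := by
    have h1 : q (WithLp.toLp 2 x) = ∑ i, ∑ j, A j i * x j * x i := by
      rw [hq, Finset.sum_comm]
    have h2 : q (WithLp.toLp 2 x) = ∑ i, ∑ j, A i j * x i * x j := hq _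
    have h3 : x ⬝ᵥ (M.mulVec x) =
        ((∑ i, ∑ j, A i j * x i * x j) + ∑ i, ∑ j, A j i * x j * x i) / 2 := by
      simp only [dotProduct, Matrix.mulVec, M, Matrix.of_apply, Finset.mul_sum,
        ← Finset.sum_add_distrib, Finset.sum_div]
      refine Finset.sum_congr rfl fun i _ => Finset.sum_congr rfl fun j _ => ?_
      ring
    rw [h3, ← h1, ← h2]
    ring
  have hpd : M.PosDef := by
    refine .of_dotProduct_mulVec_pos ?_ fun x hx => ?_
    · ext i j
      simp [M, add_comm]
    · rw [star_trivial, hM]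
      exact hpos _ (by simpa using hx)
  obtain ⟨B, hB⟩ := CStarAlgebra.nonneg_iff_eq_star_mul_self.mp hpd.posSemidef.nonneg
  have hnorm (x : EuclideanSpace ℝ (Fin d)) : q x = ‖Matrix.toEuclideanLin B x‖ ^ 2 := by
    rw [show q x = q (WithLp.toLp 2 x.ofLp) from rfl, ← hM, hB, ← Matrix.mulVec_mulVec,
      Matrix.dotProduct_mulVec, Matrix.star_eq_conjTranspose,
      Matrix.conjTranspose_eq_transpose_of_trivial,
      Matrix.vecMul_transpose, EuclideanSpace.real_norm_sq_eq]
    simp [dotProduct, Matrix.toEuclideanLin, pow_two]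
  have hinj : Function.Injective (Matrix.toEuclideanLin B) := by
    rw [← LinearMap.ker_eq_bot, LinearMap.ker_eq_bot']
    intro x hx
    by_contra hne
    have := hpos x hne
    rw [hnorm, hx] at this
    simp at this
  exact ⟨(LinearEquiv.ofInjectiveEndo _ hinj).toContinuousLinearEquiv, hnorm⟩

lemma exists_inner_apply_apply_eq
    (T : EuclideanSpace ℝ (Fin d) ≃L[ℝ] EuclideanSpace ℝ (Fin d)) :
    ∃ T' : EuclideanSpace ℝ (Fin d) ≃L[ℝ] EuclideanSpace ℝ (Fin d),
      ∀ w x, ⟪T' w, T x⟫ = ⟪w, x⟫ := by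
  let S := (T.symm : EuclideanSpace ℝ (Fin d) →L[ℝ] EuclideanSpace ℝ (Fin d)).adjoint
  have hS (w x : EuclideanSpace ℝ (Fin d)) : ⟪S w, T x⟫ = ⟪w, x⟫ := by
    simp [S, ContinuousLinearMap.adjoint_inner_left]
  have hinj : Function.Injective (S : EuclideanSpace ℝ (Fin d) →ₗ[ℝ] EuclideanSpace ℝ (Fin d)) := by
    rw [← LinearMap.ker_eq_bot, LinearMap.ker_eq_bot']
    intro w hw
    have := hS w w
    rw [show S w = 0 from hw, inner_zero_left] at this
    exact inner_self_eq_zero.1 this.symm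
  exact ⟨(LinearEquiv.ofInjectiveEndo _ hinj).toContinuousLinearEquiv, hS⟩

variable (T : EuclideanSpace ℝ (Fin d) ≃L[ℝ] EuclideanSpace ℝ (Fin d))

lemma integral_exp_norm_apply_sq :
    ∫ x, Real.exp (-Real.pi * ‖T x‖ ^ 2) = invCovolume T := by
  rw [integral_comp_eq_invCovolume_smul T fun y => Real.exp (-Real.pi * ‖y‖ ^ 2),
    GaussianFourier.integral_rexp_neg_mul_sq_norm Real.pi_pos]
  simp [Real.pi_ne_zero]

lemma integral_sphere_norm_apply_rpow (hd : 0 < d) :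
    ∫ ω : sphere (0 : EuclideanSpace ℝ (Fin d)) 1, ‖T ω‖ ^ (-(d : ℝ)) ∂(sphereMeasure d) =
      2 * Real.pi ^ ((d : ℝ) / 2) * invCovolume T / Real.Gamma ((d : ℝ) / 2) := by
  rw [sphereMeasure]
  have hd' : (0 : ℝ) < d := by exact_mod_cast hd
  have : Nonempty (Fin d) := ⟨⟨0, hd⟩⟩
  have hint : Integrable fun x => Real.exp (-Real.pi * ‖T x‖ ^ 2) := by
    by_contra h
    exact (invCovolume_pos T).ne' (by rw [← integral_exp_norm_apply_sq, integral_undef h])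
  let F : sphere (0 : EuclideanSpace ℝ (Fin d)) 1 × Set.Ioi (0 : ℝ) → ℝ :=
    fun p => Real.exp (-Real.pi * ‖T p.1‖ ^ 2 * (p.2 : ℝ) ^ (2 : ℝ))
  have hF (x : ({(0)}ᶜ : Set (EuclideanSpace ℝ (Fin d)))) :
      F (homeomorphUnitSphereProd _ x) = Real.exp (-Real.pi * ‖T x‖ ^ 2) := by
    have hx : ‖(x : EuclideanSpace ℝ (Fin d))‖ ≠ 0 := norm_ne_zero_iff.2 x.2
    simp only [F, homeomorphUnitSphereProd_apply_snd_coe, homeomorphUnitSphereProd_apply_fst_coe,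
      map_smul, norm_smul, norm_inv, norm_norm, Real.rpow_two]
    field_simp
  have hmp :=
    (volume : Measure (EuclideanSpace ℝ (Fin d))).measurePreserving_homeomorphUnitSphereProd
  have hemb := (homeomorphUnitSphereProd (EuclideanSpace ℝ (Fin d))).measurableEmbedding
  have hFint : Integrable F (volume.toSphere.prod (.volumeIoiPow (d - 1))) := by
    have h1 := (hmp.integrable_comp_emb hemb (g := F)).1 (by
      simp only [Function.comp_def, hF]
      exact (integrableOn_iff_comap_subtypeVal (measurableSet_singleton _).compl).1
        (hint.integrableOn))
    simpa using h1
  have key : ∫ x, Real.exp (-Real.pi * ‖T x‖ ^ 2) =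
      ∫ p, F p ∂(volume.toSphere.prod (.volumeIoiPow (d - 1))) := by
    have h1 := hmp.integral_comp hemb F
    simp only [hF] at h1
    rw [integral_subtype_comap (measurableSet_singleton _).compl
      fun x => Real.exp (-Real.pi * ‖T x‖ ^ 2), restrict_compl_singleton] at h1
    simpa using h1
  have hinner (ω : sphere (0 : EuclideanSpace ℝ (Fin d)) 1) :
      ∫ r, F (ω, r) ∂(Measure.volumeIoiPow (d - 1)) =
        (Real.pi ^ (-((d : ℝ) / 2)) * (1 / 2) * Real.Gamma ((d : ℝ) / 2)) * ‖T ω‖ ^ (-(d : ℝ)) := by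
    have hω : 0 < ‖T ω‖ := norm_pos_iff.2 fun h => by
      have : (ω : EuclideanSpace ℝ (Fin d)) = 0 := by simpa using h
      have h2 := norm_eq_of_mem_sphere ω
      simp [this] at h2
    have hb : 0 < Real.pi * ‖T ω‖ ^ 2 := by positivity
    simp only [Measure.volumeIoiPow, ENNReal.ofReal]
    rw [integral_withDensity_eq_integral_smul
        (measurable_subtype_coe.pow_const _).real_toNNReal,
      integral_subtype_comap measurableSet_Ioi fun a : ℝ =>
        Real.toNNReal (a ^ (d - 1)) • Real.exp (-Real.pi * ‖T ω‖ ^ 2 * a ^ (2 : ℝ)),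
      setIntegral_congr_fun (g := fun r : ℝ =>
        r ^ ((d : ℝ) - 1) * Real.exp (-(Real.pi * ‖T ω‖ ^ 2) * r ^ (2 : ℝ)))
        measurableSet_Ioi fun r hr => ?_,
      _root_.integral_rpow_mul_exp_neg_mul_rpow two_pos (by linarith) hb]
    · rw [sub_add_cancel, Real.mul_rpow Real.pi_pos.le (by positivity), neg_div,
        ← Real.rpow_natCast, ← Real.rpow_mul hω.le]
      rw [show ((2 : ℕ) : ℝ) * -((d : ℝ) / 2) = -d by push_cast; ring]
      ring
    · have hr' : (0 : ℝ) < r := hr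
      simp only [NNReal.smul_def, Real.coe_toNNReal _ (pow_nonneg hr'.le _), smul_eq_mul, neg_mul]
      rw [← Real.rpow_natCast, Nat.cast_pred hd]
  rw [integral_exp_norm_apply_sq, integral_prod _ hFint] at key
  simp_rw [hinner] at key
  rw [integral_const_mul, Real.rpow_neg Real.pi_pos.le] at key
  have hG := (Real.Gamma_pos_of_pos (half_pos hd')).ne'
  have hp := (Real.rpow_pos_of_pos Real.pi_pos ((d : ℝ) / 2)).ne'
  rw [key]
  field_simp

lemma latticeTheta_one_div {T T' : EuclideanSpace ℝ (Fin d) ≃L[ℝ] EuclideanSpace ℝ (Fin d)}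
    (hT : ∀ w x, ⟪T' w, T x⟫ = ⟪w, x⟫) {t : ℝ} (ht : 0 < t) :
    latticeTheta T (1 / t) = invCovolume T * t ^ ((d : ℝ) / 2) * latticeTheta T' t := by
  rw [latticeTheta_eq T hT (one_div_pos.2 ht), one_div, inv_inv, Real.inv_rpow ht.le,
    ← Real.rpow_neg ht.le, neg_div, neg_neg]

/-- The functional equation of `latticeTheta`, packaged for the Mellin transform machinery. -/
def latticeFEPair (hd : 0 < d)
    (T T' : EuclideanSpace ℝ (Fin d) ≃L[ℝ] EuclideanSpace ℝ (Fin d))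
    (hT : ∀ w x, ⟪T' w, T x⟫ = ⟪w, x⟫) : WeakFEPair ℂ where
  f t := latticeTheta T t
  g t := latticeTheta T' t
  k := d / 2
  ε := invCovolume T
  f₀ := 1
  g₀ := 1
  hf_int := locallyIntegrableOn_latticeTheta T
  hg_int := locallyIntegrableOn_latticeTheta T'
  hk := by positivity
  hε := by exact_mod_cast (invCovolume_pos T).ne'
  h_feq t ht := by
    rw [latticeTheta_one_div hT ht]
    simp
  hf_top := latticeTheta_sub_one_isBigO T
  hg_top := latticeTheta_sub_one_isBigO T'

lemma tsum_norm_apply_sq_cpow (hd : 0 < d)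
    (T T' : EuclideanSpace ℝ (Fin d) ≃L[ℝ] EuclideanSpace ℝ (Fin d))
    (hT : ∀ w x, ⟪T' w, T x⟫ = ⟪w, x⟫) {s : ℂ} (hs : (d : ℝ) / 2 < s.re) :
    ∑' n : {n : Fin d → ℤ // n ≠ 0}, ((‖T (intVec n.1)‖ ^ 2 : ℝ) : ℂ) ^ (-s) =
      (Real.pi : ℂ) ^ s * (Gamma s)⁻¹ * (latticeFEPair hd T T' hT).Λ s := by
  have hs0 : 0 < s.re := lt_of_le_of_lt (by positivity) hs
  have hπ : (Real.pi : ℂ) ≠ 0 := by exact_mod_cast Real.pi_ne_zero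
  have h := hasSum_mellin_pi_mul (a := fun _ : {n : Fin d → ℤ // n ≠ 0} => (1 : ℂ))
    (q := fun n => ‖T (intVec n.1)‖ ^ 2) (F := fun t => (latticeTheta T t : ℂ) - 1) (s := s)
    (fun n => .inr (pow_pos (norm_apply_intVec_pos T n.2) 2)) hs0
    (fun t ht => by
      have := (hasSum_latticeTheta_sub_one T ht)
      simp only [one_mul]
      exact_mod_cast this)
    (by
      have := (summable_norm_apply_intVec_rpow T (r := -2 * s.re) (by linarith)).comp_injective
        (Subtype.val_injective (p := fun n : Fin d → ℤ => n ≠ 0))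
      refine this.congr fun n => ?_
      rw [norm_one, one_div, ← Real.rpow_natCast, ← Real.rpow_mul (norm_nonneg _),
        ← Real.rpow_neg (norm_nonneg _)]
      simp)
  rw [((latticeFEPair hd T T' hT).hasMellin hs).2.symm]
  have h2 := (h.mul_left ((Real.pi : ℂ) ^ s * (Gamma s)⁻¹)).tsum_eq
  refine Eq.trans (tsum_congr fun n => ?_) h2
  rw [cpow_neg, cpow_neg, mul_one]
  have hG := Gamma_ne_zero_of_re_pos hs0
  have hp : (Real.pi : ℂ) ^ s ≠ 0 := by simp [cpow_eq_zero_iff, hπ]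
  field_simp

theorem exists_differentiable_tsum_norm_apply_sq_cpow (hd : 0 < d)
    (T : EuclideanSpace ℝ (Fin d) ≃L[ℝ] EuclideanSpace ℝ (Fin d)) :
    ∃ g : ℂ → ℂ, Differentiable ℂ g ∧ ∀ s : ℂ, (d : ℝ) / 2 < s.re →
      ∑' n : {n : Fin d → ℤ // n ≠ 0}, ((‖T (intVec n.1)‖ ^ 2 : ℝ) : ℂ) ^ (-s) =
        g s + (1 / (2 * s - (d : ℂ))) *
          (∫ ω : sphere (0 : EuclideanSpace ℝ (Fin d)) 1,
            ‖T ω‖ ^ (-(d : ℝ)) ∂(sphereMeasure d) : ℝ) := by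
  obtain ⟨T', hT⟩ := exists_inner_apply_apply_eq T
  set P := latticeFEPair hd T T' hT with hP
  have hπ : (Real.pi : ℂ) ≠ 0 := by exact_mod_cast Real.pi_ne_zero
  have hpow : Differentiable ℂ fun s : ℂ => (Real.pi : ℂ) ^ s := fun s =>
    differentiableAt_id.const_cpow (.inl hπ)
  let h : ℂ → ℂ := fun s => (Real.pi : ℂ) ^ s * (Gamma s)⁻¹ * invCovolume T
  have hdiff : Differentiable ℂ h := (hpow.mul differentiable_one_div_Gamma).mul_const _
  have hres : h (d / 2) = ((∫ ω : sphere (0 : EuclideanSpace ℝ (Fin d)) 1,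
      ‖T ω‖ ^ (-(d : ℝ)) ∂(sphereMeasure d) : ℝ) : ℂ) / 2 := by
    rw [integral_sphere_norm_apply_rpow T hd]
    push_cast [Complex.ofReal_cpow Real.pi_pos.le, ← Complex.Gamma_ofReal, h]
    ring
  refine ⟨fun s => (Real.pi : ℂ) ^ s * (Gamma s)⁻¹ * P.Λ₀ s
    - (Real.pi : ℂ) ^ s * (Gamma (s + 1))⁻¹ + dslope h (d / 2) s, ?_, fun s hs => ?_⟩
  · refine (((hpow.mul differentiable_one_div_Gamma).mul P.differentiable_Λ₀).sub
      (hpow.mul (differentiable_one_div_Gamma.comp (differentiable_id.add_const 1)))).add ?_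
    rw [← differentiableOn_univ] at hdiff ⊢
    exact (Complex.differentiableOn_dslope univ_mem).2 hdiff
  · have hs0 : 0 < s.re := lt_of_le_of_lt (by positivity) hs
    have hs1 : s ≠ 0 := by rintro rfl; simp at hs0
    have hsd : s ≠ d / 2 := by
      rintro rfl
      have : ((d : ℂ) / 2).re = (d : ℝ) / 2 := by simp
      exact hs.ne' this
    have hsd' : s - d / 2 ≠ 0 := sub_ne_zero.2 hsd
    have hsd'' : 2 * s - d ≠ 0 := fun h0 => hsd' (by linear_combination h0 / 2)
    have hΛ : P.Λ s = P.Λ₀ s - 1 / s - invCovolume T / (d / 2 - s) := by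
      have := P.Λ₀_eq s
      simp only [hP, latticeFEPair, smul_eq_mul, mul_one, ofReal_div, ofReal_natCast,
        ofReal_ofNat] at this ⊢
      rw [this]
      ring
    have hI : ((∫ ω : sphere (0 : EuclideanSpace ℝ (Fin d)) 1,
      ‖T ω‖ ^ (-(d : ℝ)) ∂(sphereMeasure d) : ℝ) : ℂ) = 2 * h (d / 2) := by rw [hres]; ring
    beta_reduce
    rw [tsum_norm_apply_sq_cpow hd T T' hT hs, ← hP, hΛ, hI, dslope_of_ne _ hsd, slope,
      Gamma_add_one s hs1, vsub_eq_sub, smul_eq_mul]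
    have hG := Gamma_ne_zero_of_re_pos hs0
    have hh : h s = (Real.pi : ℂ) ^ s * (Gamma s)⁻¹ * invCovolume T := rfl
    have e1 : 1 / (2 * s - d) * (2 * h (d / 2)) = (s - d / 2)⁻¹ * h (d / 2) := by
      field_simp
    have e2 : (invCovolume T : ℂ) / (d / 2 - s) = -((s - d / 2)⁻¹ * invCovolume T) := by
      rw [← neg_sub s, div_neg, div_eq_inv_mul]
    rw [e1, e2, hh, mul_inv]
    ring

end Epstein

/-- **Meromorphic continuation of the Epstein zeta function of a positive definite quadratic
form `q` on `ℝ^d`:** there is an entire function `g` with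
`Σ_{n∈ℤ^d∖{0}} q(n)^{−s} = g(s) + (1/(2s−d)) ∫_{S^{d−1}} q(ω)^{−d/2} dμ_S(ω)` for
`Re(s) > d/2`; in particular `Z_q` extends meromorphically to `ℂ` with a single simple pole at
`s = d/2` of residue `(1/2) ∫_{S^{d−1}} q(ω)^{−d/2} dμ_S(ω)`. -/
theorem epstein_zeta_meromorphic_continuation {d : ℕ} (hd : 0 < d)
    (A : Fin d → Fin d → ℝ)
    (q : EuclideanSpace ℝ (Fin d) → ℝ)
    (hq : ∀ x : EuclideanSpace ℝ (Fin d), q x = ∑ i, ∑ j, A i j * x i * x j)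
    (hpos : ∀ x : EuclideanSpace ℝ (Fin d), x ≠ 0 → 0 < q x) :
    ∃ g : ℂ → ℂ, Differentiable ℂ g ∧
      ∀ s : ℂ, (d : ℝ) / 2 < s.re →
        ∑' n : {n : Fin d → ℤ // n ≠ 0}, ((q (intVec n.1) : ℝ) : ℂ) ^ (-s)
          = g s + (1 / (2 * s - (d : ℂ))) *
              ∫ ω : sphere (0 : EuclideanSpace ℝ (Fin d)) 1,
                ((q ω : ℝ) : ℂ) ^ (-(d : ℂ) / 2) ∂(sphereMeasure d) := by
  obtain ⟨T, hT⟩ := exists_norm_apply_sq_eq A q hq hpos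
  obtain ⟨g, hg, h⟩ := exists_differentiable_tsum_norm_apply_sq_cpow hd T
  refine ⟨g, hg, fun s hs => ?_⟩
  simp only [hT]
  rw [h s hs, ← integral_complex_ofReal]
  refine congrArg (fun I => g s + 1 / (2 * s - (d : ℂ)) * I)
    (integral_congr_ae (ae_of_all _ fun ω => ?_))
  have h2 : ((‖T ω‖ ^ 2 : ℝ) ^ (-(d : ℝ) / 2) : ℝ) = ‖T ω‖ ^ (-(d : ℝ)) := by
    rw [← Real.rpow_natCast, ← Real.rpow_mul (norm_nonneg _)]
    congr 1
    push_cast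
    ring
  simp only [← h2]
  rw [Complex.ofReal_cpow (sq_nonneg _)]
  push_cast
  rfl
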